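/- arXiv:2009.03026 — 2 statements merged into one kernel-verified Lean document; each statement's English description precedes it below -/
import Mathlib

section
/- Let n ≥ 2 and β > -2/n. For the Gaussian beta ensemble, ⟨p₄(λ)⟩_{β,n} = 2(β/2)²n³ + 5(β/2)(1-β/2)n² + ((β/2) + 3(1-β/2)²)n, where p₄(λ) = Σ_j λ_j⁴. -/
open MeasureTheory ProbabilityTheory Real

/-- The index set of pairs `i < j`. -/
abbrev ltPairs (n : ℕ) : Finset (Fin n × Fin n) :=
  Finset.univ.filter (fun p : Fin n × Fin n => p.1 < p.2)

/-- The unnormalised density of the Gaussian beta ensemble. -/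
noncomputable def gbeWeight {n : ℕ} (β : ℝ) (l : Fin n → ℝ) : ℝ :=
  |∏ p ∈ ltPairs n, (l p.2 - l p.1)| ^ β * exp (-(∑ j, l j ^ 2) / 2)

@[to_additive]
lemma prod_ltPairs {M : Type*} [CommMonoid M] {n : ℕ} (f : Fin n × Fin n → M) :
    ∏ p ∈ ltPairs n, f p = ∏ i, ∏ j ∈ Finset.Ioi i, f (i, j) := by
  rw [Finset.prod_filter, Fintype.prod_prod_type]
  refine Finset.prod_congr rfl fun i _ => ?_
  rw [← Finset.prod_filter]
  refine Finset.prod_congr ?_ fun _ _ => rfl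
  ext j
  simp

lemma integrable_abs_rpow_mul_exp_neg_mul_sq {b : ℝ} (hb : 0 < b) {s : ℝ} (hs : -1 < s) :
    Integrable fun x : ℝ => |x| ^ s * exp (-b * x ^ 2) := by
  have h := (integrable_rpow_mul_exp_neg_mul_sq hb hs).norm
  refine (h.add h.comp_neg).mono' (by fun_prop) (.of_forall fun x => ?_)
  rw [norm_of_nonneg (by positivity)]
  simp only [Pi.add_apply, neg_sq, norm_mul, norm_of_nonneg (exp_nonneg _)]
  rcases le_total 0 x with hx | hx
  · rw [abs_of_nonneg hx, ← add_mul, norm_of_nonneg (rpow_nonneg hx s)]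
    gcongr
    simp
  · rw [abs_of_nonpos hx, ← add_mul, norm_of_nonneg (rpow_nonneg (neg_nonneg.2 hx) s)]
    gcongr
    simp

lemma abs_prod_ltPairs_rpow_le {n : ℕ} (hn : n ≠ 0) (β : ℝ) (l : Fin n → ℝ) :
    |∏ p ∈ ltPairs n, (l p.2 - l p.1)| ^ β
      ≤ ∑ i, ∏ j ∈ {i}ᶜ, |l j - l i| ^ (n * β / 2) := by
  have hn' : (0 : ℝ) < n := by positivity
  have hamgm := geom_mean_le_arith_mean_weighted Finset.univ (fun _ : Fin n => (n : ℝ)⁻¹)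
    (fun i => ∏ j ∈ ({i}ᶜ : Finset (Fin n)), |l j - l i| ^ (n * β / 2))
    (fun _ _ => by positivity) (by simp [hn'.ne']) (fun i _ => by positivity)
  have hprod : |∏ p ∈ ltPairs n, (l p.2 - l p.1)| ^ β
      = ∏ i, (∏ j ∈ {i}ᶜ, |l j - l i| ^ (n * β / 2)) ^ (n : ℝ)⁻¹ := by
    have h (i : Fin n) : (∏ j ∈ {i}ᶜ, |l j - l i| ^ (n * β / 2)) ^ (n : ℝ)⁻¹
        = ∏ j ∈ {i}ᶜ, |l j - l i| ^ (β / 2) := by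
      rw [← finsetProd_rpow _ _ fun _ _ => by positivity]
      refine Finset.prod_congr rfl fun j _ => ?_
      rw [← rpow_mul (abs_nonneg _)]
      congr 1
      field_simp
    simp_rw [h]
    rw [← Finset.prod_prod_Ioi_mul_eq_prod_prod_off_diag (fun j i => |l j - l i| ^ (β / 2)),
      Finset.abs_prod, ← finsetProd_rpow _ _ fun _ _ => by positivity, prod_ltPairs]
    refine Finset.prod_congr rfl fun i _ => Finset.prod_congr rfl fun j _ => ?_
    rw [abs_sub_comm (l i) (l j), ← sq, ← rpow_mul_natCast (abs_nonneg _)]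
    congr 1
    push_cast
    ring
  rw [hprod]
  refine hamgm.trans (Finset.sum_le_sum fun i _ => mul_le_of_le_one_left (by positivity) ?_)
  exact inv_le_one_of_one_le₀ (by exact_mod_cast Nat.one_le_iff_ne_zero.2 hn)

lemma integrable_star {n : ℕ} {b α : ℝ} (hb : 0 < b) (hα : -1 < α) (i : Fin n) :
    Integrable fun l : Fin n → ℝ =>
      (∏ j ∈ {i}ᶜ, |l j - l i| ^ α) * exp (-b * ∑ j, l j ^ 2) := by
  classical
  let S : (Fin n → ℝ) →ₗ[ℝ] (Fin n → ℝ) :=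
    LinearMap.pi fun j => if j = i then (LinearMap.proj i : (Fin n → ℝ) →ₗ[ℝ] ℝ) else
      (LinearMap.proj j : (Fin n → ℝ) →ₗ[ℝ] ℝ) - LinearMap.proj i
  have hSi (l : Fin n → ℝ) : S l i = l i := by simp [S]
  have hSj (l : Fin n → ℝ) {j : Fin n} (hj : j ≠ i) : S l j = l j - l i := by simp [S, hj]
  have hdet : LinearMap.det S ≠ 0 := by
    refine (LinearMap.isUnit_det S ?_).ne_zero
    rw [LinearMap.isUnit_iff_ker_eq_bot, LinearMap.ker_eq_bot']
    intro l hl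
    have hi : l i = 0 := by rw [← hSi l, hl]; rfl
    ext j
    by_cases hj : j = i
    · simpa [hj] using hi
    · have := hSj l hj
      rw [hl, hi] at this
      simpa using this.symm
  set c : ℝ := b / (2 * n + 2) with hc
  have hc0 : 0 < c := by positivity
  have hF : Integrable fun m : Fin n → ℝ =>
      ∏ j, (if j = i then exp (-c * m j ^ 2) else |m j| ^ α * exp (-c * m j ^ 2)) := by
    refine Integrable.fintype_prod
      (f := fun j x => if j = i then exp (-c * x ^ 2) else |x| ^ α * exp (-c * x ^ 2)) fun j => ?_
    split_ifs
    · exact integrable_exp_neg_mul_sq hc0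
    · exact integrable_abs_rpow_mul_exp_neg_mul_sq hc0 hα
  have hFS : Integrable ((fun m : Fin n → ℝ =>
      ∏ j, (if j = i then exp (-c * m j ^ 2) else |m j| ^ α * exp (-c * m j ^ 2))) ∘ S) := by
    refine Integrable.comp_measurable ?_ (LinearMap.continuous_of_finiteDimensional S).measurable
    rw [Real.map_linearMap_volume_pi_eq_smul_volume_pi hdet]
    exact hF.smul_measure ENNReal.ofReal_ne_top
  refine hFS.mono' (by fun_prop) (.of_forall fun l => ?_)
  rw [norm_of_nonneg (by positivity)]
  have hprod : (∏ j, (if j = i then exp (-c * S l j ^ 2) else |S l j| ^ α * exp (-c * S l j ^ 2)))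
      = (∏ j ∈ {i}ᶜ, |l j - l i| ^ α) * exp (-c * ∑ j, S l j ^ 2) := by
    have h (j : Fin n) : (if j = i then exp (-c * S l j ^ 2) else
        |S l j| ^ α * exp (-c * S l j ^ 2))
        = (if j ∈ ({i}ᶜ : Finset (Fin n)) then |l j - l i| ^ α else 1) * exp (-c * S l j ^ 2) := by
      by_cases hj : j = i
      · simp [hj]
      · simp [hj, hSj l hj]
    simp_rw [h]
    rw [Finset.prod_mul_distrib, Finset.prod_ite_mem, Finset.univ_inter, ← exp_sum, Finset.mul_sum]
  simp only [Function.comp_apply]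
  rw [hprod]
  gcongr ?_ * exp ?_
  have hbound : ∑ j, S l j ^ 2 ≤ (2 * n + 2) * ∑ j, l j ^ 2 := by
    have hle (j : Fin n) : S l j ^ 2 ≤ 2 * l j ^ 2 + 2 * l i ^ 2 := by
      by_cases hj : j = i
      · rw [hj, hSi]; nlinarith [sq_nonneg (l i)]
      · rw [hSj l hj]; nlinarith [sq_nonneg (l j + l i)]
    have hli : l i ^ 2 ≤ ∑ j, l j ^ 2 :=
      Finset.single_le_sum (f := fun j => l j ^ 2) (fun _ _ => sq_nonneg _) (Finset.mem_univ i)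
    refine (Finset.sum_le_sum fun j _ => hle j).trans ?_
    rw [Finset.sum_add_distrib, ← Finset.mul_sum]
    simp only [Finset.sum_const, Finset.card_univ, Fintype.card_fin, nsmul_eq_mul]
    have : (n : ℝ) * l i ^ 2 ≤ n * ∑ j, l j ^ 2 := by gcongr
    linarith
  have : b = c * (2 * n + 2) := by rw [hc]; field_simp
  rw [this]
  nlinarith

lemma gbeWeight_nonneg {n : ℕ} (β : ℝ) (l : Fin n → ℝ) : 0 ≤ gbeWeight β l := by
  unfold gbeWeight
  positivity

lemma measurable_gbeWeight {n : ℕ} (β : ℝ) : Measurable (gbeWeight (n := n) β) := by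
  unfold gbeWeight
  fun_prop

lemma pow_mul_exp_le (N : ℕ) {x : ℝ} (hx : 0 ≤ x) :
    (2 + 3 * x) ^ N * exp (-x / 2) ≤ (12 ^ N * N.factorial * exp (1 / 6)) * exp (-(1 / 4) * x) := by
  have h := pow_div_factorial_le_exp (x := (2 + 3 * x) / 12) (by positivity) N
  rw [div_pow, div_div, div_le_iff₀ (by positivity)] at h
  calc (2 + 3 * x) ^ N * exp (-x / 2)
      ≤ (exp ((2 + 3 * x) / 12) * (12 ^ N * N.factorial)) * exp (-x / 2) := by gcongr
    _ = (12 ^ N * N.factorial) * (exp ((2 + 3 * x) / 12) * exp (-x / 2)) := by ring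
    _ = (12 ^ N * N.factorial) * (exp (1 / 6) * exp (-(1 / 4) * x)) := by
      rw [← exp_add, ← exp_add]
      congr 2
      ring
    _ = _ := by ring

lemma integrable_gbeWeight_mul_pow {n : ℕ} (hn : n ≠ 0) {β : ℝ} (hβ : -2 / n < β) (N : ℕ) :
    Integrable fun l : Fin n → ℝ => gbeWeight β l * (2 + 3 * ∑ j, l j ^ 2) ^ N := by
  have hα : -1 < (n : ℝ) * β / 2 := by
    have : (0 : ℝ) < n := by positivity
    rw [div_lt_iff₀ this] at hβ
    linarith
  refine ((integrable_finsetSum Finset.univ fun i _ =>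
    integrable_star (n := n) (b := 1 / 4) (by norm_num) hα i).const_mul
    (12 ^ N * N.factorial * exp (1 / 6))).mono'
    (((measurable_gbeWeight β).mul (by fun_prop)).aestronglyMeasurable) (.of_forall fun l => ?_)
  have hp : 0 ≤ ∑ j, l j ^ 2 := by positivity
  rw [norm_of_nonneg (mul_nonneg (gbeWeight_nonneg β l) (by positivity)), ← Finset.sum_mul,
    gbeWeight]
  calc _ = |∏ p ∈ ltPairs n, (l p.2 - l p.1)| ^ β *
        ((2 + 3 * ∑ j, l j ^ 2) ^ N * exp (-(∑ j, l j ^ 2) / 2)) := by ring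
    _ ≤ (∑ i, ∏ j ∈ {i}ᶜ, |l j - l i| ^ (n * β / 2)) *
        ((12 ^ N * N.factorial * exp (1 / 6)) * exp (-(1 / 4) * ∑ j, l j ^ 2)) := by
      exact mul_le_mul (abs_prod_ltPairs_rpow_le hn β l) (pow_mul_exp_le N hp) (by positivity)
        (by positivity)
    _ = _ := by ring

lemma integrable_gbeWeight_mul {n : ℕ} (hn : n ≠ 0) {β : ℝ} (hβ : -2 / n < β)
    {g : (Fin n → ℝ) → ℝ} (hg : Measurable g) (C : ℝ) (N : ℕ)
    (hgC : ∀ l, |g l| ≤ C * (2 + 3 * ∑ j, l j ^ 2) ^ N) :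
    Integrable fun l => gbeWeight β l * g l := by
  refine ((integrable_gbeWeight_mul_pow hn hβ N).const_mul C).mono'
    ((measurable_gbeWeight β).mul hg).aestronglyMeasurable (.of_forall fun l => ?_)
  rw [norm_mul, norm_of_nonneg (gbeWeight_nonneg β l), norm_eq_abs, mul_left_comm]
  exact mul_le_mul_of_nonneg_left (hgC l) (gbeWeight_nonneg β l)

lemma abs_exp_sub_one_le_mul (x : ℝ) : |exp x - 1| ≤ |x| * (1 + exp x) := by
  have h1 := add_one_le_exp x
  have h2 := add_one_le_exp (-x)
  have h3 : exp x * exp (-x) = 1 := by rw [← exp_add]; simp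
  have h4 := exp_pos x
  rcases le_total 0 x with hx | hx
  · rw [abs_of_nonneg hx, abs_of_nonneg (by linarith)]
    nlinarith
  · rw [abs_of_nonpos hx, abs_of_nonpos (by linarith [exp_le_one_iff.2 hx])]
    nlinarith

/-- If the weight is invariant under multiplication by `exp (h t)`, `t > 0`, after integration, then
the derivative of `h` at `t = 0` has mean zero. -/
lemma integral_gbeWeight_mul_deriv_eq_zero {n : ℕ} (hn : n ≠ 0) {β : ℝ} (hβ : -2 / n < β)
    {h : ℝ → (Fin n → ℝ) → ℝ} {H : (Fin n → ℝ) → ℝ} (hmeas : ∀ t, Measurable (h t))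
    (hzero : ∀ l, h 0 l = 0) (hderiv : ∀ l, HasDerivAt (fun t => h t l) (H l) 0)
    (C : ℝ) (M N : ℕ)
    (hC : ∀ t l, 0 < t → t ≤ 1 → |h t l| ≤ t * (C * (2 + 3 * ∑ j, l j ^ 2) ^ M))
    (hN : ∀ t l, 0 < t → t ≤ 1 → exp (h t l) ≤ (2 + 3 * ∑ j, l j ^ 2) ^ N)
    (hinv : ∀ t, 0 < t → ∫ l, gbeWeight β l * exp (h t l) = ∫ l : Fin n → ℝ, gbeWeight β l) :
    ∫ l, gbeWeight β l * H l = 0 := by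
  have hIoc : Set.Ioc (0 : ℝ) 1 ∈ nhdsWithin 0 (Set.Ioi 0) := Ioc_mem_nhdsGT one_pos
  have hlim : Filter.Tendsto
      (fun t : ℝ => ∫ l : Fin n → ℝ, gbeWeight β l * (t⁻¹ * (exp (h t l) - 1)))
      (nhdsWithin 0 (Set.Ioi 0)) (nhds (∫ l, gbeWeight β l * H l)) := by
    refine tendsto_integral_filter_of_dominated_convergence
      (fun l => gbeWeight β l * (C * (2 + 3 * ∑ j, l j ^ 2) ^ M *
        (1 + (2 + 3 * ∑ j, l j ^ 2) ^ N))) ?_ ?_ ?_ ?_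
    · refine .of_forall fun t => ((measurable_gbeWeight β).mul ?_).aestronglyMeasurable
      have := hmeas t
      fun_prop
    · filter_upwards [hIoc] with t ht
      refine .of_forall fun l => ?_
      rw [norm_mul, norm_of_nonneg (gbeWeight_nonneg β l)]
      refine mul_le_mul_of_nonneg_left ?_ (gbeWeight_nonneg β l)
      rw [norm_mul, norm_inv, norm_of_nonneg ht.1.le, norm_eq_abs, inv_mul_le_iff₀ ht.1]
      calc _ ≤ |h t l| * (1 + exp (h t l)) := abs_exp_sub_one_le_mul _
        _ ≤ t * (C * (2 + 3 * ∑ j, l j ^ 2) ^ M) * (1 + (2 + 3 * ∑ j, l j ^ 2) ^ N) := by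
          have h1 := hC t l ht.1 ht.2
          have h2 := hN t l ht.1 ht.2
          have h3 := (abs_nonneg _).trans h1
          gcongr
        _ = _ := by ring
    · have h1 := (integrable_gbeWeight_mul_pow hn hβ M).const_mul C
      have h2 := (integrable_gbeWeight_mul_pow hn hβ (M + N)).const_mul C
      refine (h1.add h2).congr (.of_forall fun l => ?_)
      simp only [Pi.add_apply]
      ring
    · refine .of_forall fun l => Filter.Tendsto.const_mul _ ?_
      have hd := (hderiv l).exp
      rw [hzero, exp_zero, one_mul, hasDerivAt_iff_tendsto_slope] at hd
      refine (hd.mono_left (nhdsWithin_mono _ fun x hx => ne_of_gt hx)).congr fun t => ?_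
      simp [slope_def_field, hzero, div_eq_inv_mul]
  refine tendsto_nhds_unique hlim ((Filter.tendsto_congr' ?_).2 tendsto_const_nhds)
  filter_upwards [hIoc] with t ht
  have hw : Integrable fun l : Fin n → ℝ => gbeWeight β l := by
    simpa using integrable_gbeWeight_mul_pow hn hβ 0
  have hwe : Integrable fun l : Fin n → ℝ => gbeWeight β l * exp (h t l) := by
    refine integrable_gbeWeight_mul hn hβ (measurable_exp.comp (hmeas t)) 1 N fun l => ?_
    rw [abs_of_pos (exp_pos _), one_mul]
    exact hN t l ht.1 ht.2
  calc _ = ∫ l : Fin n → ℝ, t⁻¹ * (gbeWeight β l * exp (h t l) - gbeWeight β l) := by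
        congr with l
        ring
    _ = 0 := by rw [integral_const_mul, integral_sub hwe hw, hinv t ht.1, sub_self, mul_zero]

lemma gbe_p1_invariance {n : ℕ} (β : ℝ) {t : ℝ} (ht : 0 < t) :
    ∫ l : Fin n → ℝ, gbeWeight β l *
      exp (log (1 + n * t) - (t + n * t ^ 2 / 2) * (∑ j, l j) ^ 2)
      = ∫ l : Fin n → ℝ, gbeWeight β l := by
  let A : Matrix (Fin n) (Fin n) ℝ :=
    1 + Matrix.replicateCol Unit (fun _ : Fin n => t) *
      Matrix.replicateRow Unit (fun _ : Fin n => (1 : ℝ))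
  have hdet : A.det = 1 + n * t := by
    rw [Matrix.det_one_add_replicateCol_mul_replicateRow]
    simp [dotProduct]
  have hpos : 0 < 1 + n * t := by positivity
  let T : (Fin n → ℝ) →L[ℝ] (Fin n → ℝ) := LinearMap.toContinuousLinearMap (Matrix.toLin' A)
  have hT (l : Fin n → ℝ) (j : Fin n) : T l j = l j + t * ∑ i, l i := by
    change (A.mulVec l) j = _
    rw [Matrix.add_mulVec, Matrix.one_mulVec, Pi.add_apply]
    simp [Matrix.mulVec, dotProduct, Matrix.mul_apply, Finset.mul_sum]
  have hTdet : T.det = 1 + n * t := by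
    rw [← hdet, ← LinearMap.det_toLin']
    rfl
  have hbij : Function.Bijective T := by
    have : IsUnit (LinearMap.det (Matrix.toLin' A)) := by
      rw [LinearMap.det_toLin', hdet]
      exact hpos.ne'.isUnit
    exact (Module.End.isUnit_iff _).1 ((LinearMap.isUnit_iff_isUnit_det _).2 this)
  have hcov := integral_image_eq_integral_abs_det_fderiv_smul volume MeasurableSet.univ
    (fun l _ => T.hasFDerivWithinAt) hbij.injective.injOn (gbeWeight β)
  rw [Set.image_univ, hbij.surjective.range_eq, setIntegral_univ, setIntegral_univ] at hcov
  rw [hcov]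
  congr with l
  rw [hTdet, abs_of_pos hpos, exp_sub, exp_log hpos, smul_eq_mul, gbeWeight, gbeWeight]
  have hsq : ∑ j, T l j ^ 2 = ∑ j, l j ^ 2 + 2 * ((t + n * t ^ 2 / 2) * (∑ j, l j) ^ 2) := by
    simp only [hT, add_sq, Finset.sum_add_distrib, ← Finset.sum_mul, ← Finset.mul_sum]
    simp only [Finset.sum_const, Finset.card_univ, Fintype.card_fin, nsmul_eq_mul]
    ring
  have hdiff (p : Fin n × Fin n) : T l p.2 - T l p.1 = l p.2 - l p.1 := by
    rw [hT, hT]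
    ring
  simp only [hdiff, hsq]
  rw [show -(∑ j, l j ^ 2 + 2 * ((t + n * t ^ 2 / 2) * (∑ j, l j) ^ 2)) / 2
    = -(∑ j, l j ^ 2) / 2 - (t + n * t ^ 2 / 2) * (∑ j, l j) ^ 2 by ring, exp_sub]
  ring

lemma sq_sum_le_card_mul {n : ℕ} (l : Fin n → ℝ) : (∑ j, l j) ^ 2 ≤ n * ∑ j, l j ^ 2 := by
  simpa using sq_sum_le_card_mul_sum_sq (s := Finset.univ) (f := l)

lemma hasDerivAt_log_one_add_mul (c : ℝ) : HasDerivAt (fun t => log (1 + t * c)) c 0 := by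
  have h := ((hasDerivAt_id (0 : ℝ)).mul_const c).const_add 1
  simpa using h.log (by simp)

lemma gbe_p1_sq {n : ℕ} (hn : n ≠ 0) {β : ℝ} (hβ : -2 / n < β) :
    ∫ l : Fin n → ℝ, gbeWeight β l * (n - (∑ j, l j) ^ 2) = 0 := by
  refine integral_gbeWeight_mul_deriv_eq_zero hn hβ
    (h := fun t l => log (1 + n * t) - (t + n * t ^ 2 / 2) * (∑ j, l j) ^ 2)
    (fun t => by fun_prop) (fun l => by simp) (fun l => ?_) (n + (1 + n) * n) 1 n ?_ ?_
    fun t ht => gbe_p1_invariance β ht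
  · have h1 := hasDerivAt_log_one_add_mul n
    have h2 : HasDerivAt (fun t : ℝ => t + n * t ^ 2 / 2) 1 0 := by
      have := (hasDerivAt_id (0 : ℝ)).add
        ((((hasDerivAt_id (0 : ℝ)).pow 2).const_mul (n : ℝ)).div_const 2)
      exact this.congr_deriv (by simp)
    have h3 := h1.sub (h2.mul_const ((∑ j, l j) ^ 2))
    simp only [mul_comm _ (n : ℝ), one_mul] at h3
    exact h3
  · intro t l ht ht1
    have hp : 0 ≤ ∑ j, l j ^ 2 := by positivity
    have hnt : 0 ≤ n * t := by positivity
    have h1 : log (1 + n * t) ≤ n * t := by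
      linarith [log_le_sub_one_of_pos (x := 1 + n * t) (by positivity)]
    have h0 : 0 ≤ log (1 + n * t) := log_nonneg (by linarith)
    have h2 := sq_sum_le_card_mul l
    have h3 : t + n * t ^ 2 / 2 ≤ t * (1 + n) := by
      have : n * t ^ 2 ≤ n * t := by gcongr; nlinarith
      linarith
    have h4 : (t + n * t ^ 2 / 2) * (∑ j, l j) ^ 2 ≤ (t * (1 + n)) * (n * ∑ j, l j ^ 2) := by
      gcongr
    have h5 : 0 ≤ (t + n * t ^ 2 / 2) * (∑ j, l j) ^ 2 := by positivity
    have h6 : 0 ≤ (t * (1 + n)) * (n * ∑ j, l j ^ 2) := by positivity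
    have h7 : 0 ≤ t * n * ∑ j, l j ^ 2 := by positivity
    have h8 : 0 ≤ (t * (1 + n)) * n := by positivity
    rw [abs_le]
    constructor <;> nlinarith
  · intro t l ht ht1
    have hp : 0 ≤ ∑ j, l j ^ 2 := by positivity
    have hpos : 0 < 1 + n * t := by positivity
    calc exp (log (1 + n * t) - (t + n * t ^ 2 / 2) * (∑ j, l j) ^ 2)
        ≤ exp (log (1 + n * t)) := by
          gcongr
          exact sub_le_self _ (by positivity)
      _ = 1 + n * t := exp_log hpos
      _ ≤ 1 + n * 1 := by gcongr
      _ ≤ 2 ^ n := by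
        have : n + 1 ≤ 2 ^ n := Nat.lt_two_pow_self
        have : (n : ℝ) + 1 ≤ 2 ^ n := by exact_mod_cast this
        linarith
      _ ≤ _ := by
        gcongr
        linarith

/-- The divided difference of `x ↦ a * x + b * x ^ 3`. -/
def cubicSlope (a b x y : ℝ) : ℝ := a + b * (x ^ 2 + x * y + y ^ 2)

lemma cubicSlope_nonneg {a b : ℝ} (ha : 0 ≤ a) (hb : 0 ≤ b) (x y : ℝ) : 0 ≤ cubicSlope a b x y := by
  have : 0 ≤ x ^ 2 + x * y + y ^ 2 := by nlinarith [sq_nonneg (x + y), sq_nonneg x, sq_nonneg y]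
  unfold cubicSlope
  positivity

/-- The logarithmic change of the weight and the volume under
`l j ↦ l j + t * (a * l j + b * l j ^ 3)`. -/
noncomputable def cubicLogJacobian {n : ℕ} (β a b t : ℝ) (l : Fin n → ℝ) : ℝ :=
  β * ∑ p ∈ ltPairs n, log (1 + t * cubicSlope a b (l p.1) (l p.2))
    + ∑ j, log (1 + t * (a + 3 * b * l j ^ 2))
    - (t * ∑ j, l j * (a * l j + b * l j ^ 3) + t ^ 2 / 2 * ∑ j, (a * l j + b * l j ^ 3) ^ 2)

lemma bijective_add_cubic {a b t : ℝ} (ha : 0 ≤ a) (hb : 0 ≤ b) (ht : 0 < t) :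
    Function.Bijective fun x : ℝ => x + t * (a * x + b * x ^ 3) := by
  have hle (x : ℝ) (hx : 0 ≤ x) : x ≤ x + t * (a * x + b * x ^ 3) :=
    le_add_of_nonneg_right (by positivity)
  constructor
  · intro x y hxy
    have h : (x - y) * (1 + t * cubicSlope a b x y) = 0 := by
      simp only [cubicSlope] at hxy ⊢
      linear_combination hxy
    have hpos : 0 < 1 + t * cubicSlope a b x y := by
      have := cubicSlope_nonneg ha hb x y
      positivity
    exact sub_eq_zero.1 ((mul_eq_zero.1 h).resolve_right hpos.ne')
  · refine Continuous.surjective (by fun_prop) ?_ ?_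
    · refine Filter.tendsto_atTop_mono' _ ?_ Filter.tendsto_id
      filter_upwards [Filter.eventually_ge_atTop 0] with x hx using hle x hx
    · refine Filter.tendsto_atBot_mono' _ ?_ Filter.tendsto_id
      filter_upwards [Filter.eventually_le_atBot 0] with x hx
      have := hle (-x) (by linarith)
      simp only [id]
      linarith

lemma gbe_cubic_invariance {n : ℕ} (β : ℝ) {a b t : ℝ} (ha : 0 ≤ a) (hb : 0 ≤ b) (ht : 0 < t) :
    ∫ l : Fin n → ℝ, gbeWeight β l * exp (cubicLogJacobian β a b t l)
      = ∫ l : Fin n → ℝ, gbeWeight β l := by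
  let φ : ℝ → ℝ := fun x => x + t * (a * x + b * x ^ 3)
  let φ' : ℝ → ℝ := fun x => 1 + t * (a + 3 * b * x ^ 2)
  have hφ' (x : ℝ) : HasDerivAt φ (φ' x) x := by
    have h := (hasDerivAt_id x).add
      ((((hasDerivAt_id x).const_mul a).add (((hasDerivAt_id x).pow 3).const_mul b)).const_mul t)
    refine h.congr_deriv ?_
    simp only [φ', id, Nat.add_one_sub_one]
    push_cast
    ring
  have hφ'pos (x : ℝ) : 0 < φ' x := by positivity
  have hφ := bijective_add_cubic ha hb ht
  let Φ : (Fin n → ℝ) → Fin n → ℝ := fun l j => φ (l j)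
  let Φ' : (Fin n → ℝ) → (Fin n → ℝ) →L[ℝ] (Fin n → ℝ) := fun l =>
    ContinuousLinearMap.pi fun j =>
      (ContinuousLinearMap.toSpanSingleton ℝ (φ' (l j))).comp (ContinuousLinearMap.proj j)
  have hΦ' (l : Fin n → ℝ) : HasFDerivAt Φ (Φ' l) l :=
    hasFDerivAt_pi.2 fun j =>
      HasFDerivAt.comp (g := φ) (f := fun l : Fin n → ℝ => l j) l (hφ' (l j)).hasFDerivAt
        (hasFDerivAt_apply j l)
  have hdet (l : Fin n → ℝ) : (Φ' l).det = ∏ j, φ' (l j) := by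
    rw [ContinuousLinearMap.det_pi]
    simp
  have hbij : Function.Bijective Φ :=
    ⟨fun l m h => funext fun j => hφ.injective (congrFun h j), fun m =>
      ⟨fun j => (hφ.surjective (m j)).choose, funext fun j => (hφ.surjective (m j)).choose_spec⟩⟩
  have hcov := integral_image_eq_integral_abs_det_fderiv_smul volume MeasurableSet.univ
    (fun l _ => (hΦ' l).hasFDerivWithinAt) hbij.injective.injOn (gbeWeight β)
  rw [Set.image_univ, hbij.surjective.range_eq, setIntegral_univ, setIntegral_univ] at hcov
  rw [hcov]
  congr with l
  have hqpos (p : Fin n × Fin n) : 0 < 1 + t * cubicSlope a b (l p.1) (l p.2) := by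
    have := cubicSlope_nonneg ha hb (l p.1) (l p.2)
    positivity
  have hsq : -(∑ j, Φ l j ^ 2) / 2 = -(∑ j, l j ^ 2) / 2 -
      (t * ∑ j, l j * (a * l j + b * l j ^ 3) + t ^ 2 / 2 * ∑ j, (a * l j + b * l j ^ 3) ^ 2) := by
    have h (j : Fin n) : Φ l j ^ 2 = l j ^ 2 + 2 * t * (l j * (a * l j + b * l j ^ 3))
        + t ^ 2 * (a * l j + b * l j ^ 3) ^ 2 := by
      simp only [Φ, φ]
      ring
    simp only [h, Finset.sum_add_distrib, ← Finset.mul_sum]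
    ring
  have hdiff (p : Fin n × Fin n) : Φ l p.2 - Φ l p.1
      = (l p.2 - l p.1) * (1 + t * cubicSlope a b (l p.1) (l p.2)) := by
    simp only [Φ, φ, cubicSlope]
    ring
  have hvdm : |∏ p ∈ ltPairs n, (Φ l p.2 - Φ l p.1)| ^ β
      = |∏ p ∈ ltPairs n, (l p.2 - l p.1)| ^ β *
        exp (β * ∑ p ∈ ltPairs n, log (1 + t * cubicSlope a b (l p.1) (l p.2))) := by
    simp only [hdiff, Finset.prod_mul_distrib, abs_mul]
    rw [mul_rpow (abs_nonneg _) (abs_nonneg _),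
      abs_of_pos (Finset.prod_pos fun p _ => hqpos p), mul_comm β, exp_mul, exp_sum]
    simp only [exp_log (hqpos _)]
  have hjac : ∏ j, φ' (l j) = exp (∑ j, log (1 + t * (a + 3 * b * l j ^ 2))) := by
    rw [exp_sum]
    exact Finset.prod_congr rfl fun j _ => (exp_log (hφ'pos (l j))).symm
  rw [hdet, abs_of_pos (Finset.prod_pos fun j _ => hφ'pos (l j)), smul_eq_mul, gbeWeight,
    gbeWeight, hvdm, hjac, hsq, cubicLogJacobian, exp_sub, exp_sub, exp_add]
  ring

lemma two_mul_sum_ltPairs {n : ℕ} (f : Fin n → Fin n → ℝ) (hf : ∀ i j, f i j = f j i) :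
    2 * ∑ p ∈ ltPairs n, f p.1 p.2 = ∑ i, ∑ j, f i j - ∑ i, f i i := by
  have h := Finset.sum_sum_Ioi_add_eq_sum_sum_off_diag f
  have h1 : ∑ i, ∑ j ∈ Finset.Ioi i, (f j i + f i j) = 2 * ∑ p ∈ ltPairs n, f p.1 p.2 := by
    rw [sum_ltPairs, Finset.mul_sum]
    refine Finset.sum_congr rfl fun i _ => ?_
    rw [Finset.mul_sum]
    refine Finset.sum_congr rfl fun j _ => ?_
    rw [hf j i]
    ring
  rw [← h1, h, eq_sub_iff_add_eq, ← Finset.sum_add_distrib]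
  refine Finset.sum_congr rfl fun i _ => ?_
  rw [add_comm, Fintype.sum_eq_add_sum_compl i, hf i i]
  congr 1
  exact Finset.sum_congr rfl fun j _ => hf j i

lemma two_mul_sum_cubicSlope {n : ℕ} (a b : ℝ) (l : Fin n → ℝ) :
    2 * ∑ p ∈ ltPairs n, cubicSlope a b (l p.1) (l p.2)
      = a * (n ^ 2 - n) + b * ((2 * n - 3) * ∑ j, l j ^ 2 + (∑ j, l j) ^ 2) := by
  rw [two_mul_sum_ltPairs (fun i j => cubicSlope a b (l i) (l j))
    fun i j => by unfold cubicSlope; ring]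
  simp only [cubicSlope, Finset.sum_add_distrib, ← Finset.mul_sum, ← Finset.sum_mul,
    Finset.sum_const, Finset.card_univ, Fintype.card_fin, nsmul_eq_mul, ← sq]
  ring

lemma sq_le_sum_sq {n : ℕ} (l : Fin n → ℝ) (j : Fin n) : l j ^ 2 ≤ ∑ i, l i ^ 2 :=
  Finset.single_le_sum (f := fun i => l i ^ 2) (fun _ _ => sq_nonneg _) (Finset.mem_univ j)

lemma cubicSlope_le {n : ℕ} {a b : ℝ} (ha : a ≤ 1) (hb0 : 0 ≤ b) (hb : b ≤ 1)
    (l : Fin n → ℝ) (i j : Fin n) : cubicSlope a b (l i) (l j) ≤ 1 + 3 * ∑ k, l k ^ 2 := by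
  have hi := sq_le_sum_sq l i
  have hj := sq_le_sum_sq l j
  have h : l i ^ 2 + l i * l j + l j ^ 2 ≤ 3 * ∑ k, l k ^ 2 := by
    nlinarith [sq_nonneg (l i - l j)]
  have h0 : 0 ≤ 3 * ∑ k, l k ^ 2 := by positivity
  unfold cubicSlope
  nlinarith

lemma log_one_add_mul_mem {t x : ℝ} (ht : 0 ≤ t) (hx : 0 ≤ x) :
    0 ≤ log (1 + t * x) ∧ log (1 + t * x) ≤ t * x := by
  have : 0 ≤ t * x := by positivity
  exact ⟨log_nonneg (by linarith), by
    linarith [log_le_sub_one_of_pos (x := 1 + t * x) (by positivity)]⟩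

lemma card_ltPairs_le (n : ℕ) : ((ltPairs n).card : ℝ) ≤ n ^ 2 := by
  have h := Finset.card_filter_le Finset.univ (fun p : Fin n × Fin n => p.1 < p.2)
  simp only [Finset.card_univ, Fintype.card_prod, Fintype.card_fin] at h
  rw [sq]
  exact_mod_cast h

lemma abs_cubicLogJacobian_le {n : ℕ} (β : ℝ) {a b t : ℝ} (ha0 : 0 ≤ a) (ha : a ≤ 1)
    (hb0 : 0 ≤ b) (hb : b ≤ 1) (ht : 0 < t) (ht1 : t ≤ 1) (l : Fin n → ℝ) :
    |cubicLogJacobian β a b t l|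
      ≤ t * ((|β| * n ^ 2 + 3 * n) * (2 + 3 * ∑ j, l j ^ 2) ^ 3) := by
  set P := ∑ j, l j ^ 2
  have hP0 : 0 ≤ P := by positivity
  set R := 2 + 3 * P
  have hR1 : 1 ≤ R := by linarith
  have hRR : R ≤ R ^ 3 := le_self_pow₀ hR1 (by norm_num)
  have hRR2 : R ^ 2 ≤ R ^ 3 := pow_le_pow_right₀ hR1 (by norm_num)
  have h1 : |β * ∑ p ∈ ltPairs n, log (1 + t * cubicSlope a b (l p.1) (l p.2))|
      ≤ |β| * (n ^ 2 * (t * R ^ 3)) := by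
    rw [abs_mul]
    gcongr
    have hp (p : Fin n × Fin n) (_ : p ∈ ltPairs n) :
        |log (1 + t * cubicSlope a b (l p.1) (l p.2))| ≤ t * R ^ 3 := by
      have h := log_one_add_mul_mem ht.le (cubicSlope_nonneg ha0 hb0 (l p.1) (l p.2))
      rw [abs_of_nonneg h.1]
      refine h.2.trans ?_
      gcongr
      linarith [cubicSlope_le ha hb0 hb l p.1 p.2]
    calc _ ≤ ∑ p ∈ ltPairs n, |log (1 + t * cubicSlope a b (l p.1) (l p.2))| :=
          Finset.abs_sum_le_sum_abs _ _
      _ ≤ (ltPairs n).card • (t * R ^ 3) := Finset.sum_le_card_nsmul _ _ _ hp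
      _ ≤ _ := by
        rw [nsmul_eq_mul]
        gcongr
        exact card_ltPairs_le n
  have hsum (f : Fin n → ℝ) (hf : ∀ j, 0 ≤ f j) {K : ℝ} (hfK : ∀ j, f j ≤ K) :
      |∑ j, f j| ≤ n * K := by
    rw [abs_of_nonneg (Finset.sum_nonneg fun j _ => hf j)]
    simpa using Finset.sum_le_card_nsmul Finset.univ f K fun j _ => hfK j
  have h2 : |∑ j, log (1 + t * (a + 3 * b * l j ^ 2))| ≤ n * (t * R ^ 3) := by
    refine hsum _ (fun j => (log_one_add_mul_mem ht.le (by positivity)).1) fun j => ?_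
    refine (log_one_add_mul_mem ht.le (by positivity)).2.trans ?_
    gcongr
    have := sq_le_sum_sq l j
    nlinarith [sq_nonneg (l j)]
  have h3 : |∑ j, l j * (a * l j + b * l j ^ 3)| ≤ n * R ^ 3 := by
    refine hsum _ (fun j => ?_) fun j => ?_
    · rw [show l j * (a * l j + b * l j ^ 3) = a * l j ^ 2 + b * (l j ^ 2) ^ 2 by ring]
      positivity
    · have := sq_le_sum_sq l j
      have h0 := sq_nonneg (l j)
      calc l j * (a * l j + b * l j ^ 3) = a * l j ^ 2 + b * (l j ^ 2) ^ 2 := by ring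
        _ ≤ 1 * P + 1 * P ^ 2 := by gcongr
        _ ≤ R ^ 2 := by nlinarith
        _ ≤ R ^ 3 := hRR2
  have h4 : |∑ j, (a * l j + b * l j ^ 3) ^ 2| ≤ n * R ^ 3 := by
    refine hsum _ (fun j => by positivity) fun j => ?_
    have := sq_le_sum_sq l j
    calc (a * l j + b * l j ^ 3) ^ 2 = l j ^ 2 * (a + b * l j ^ 2) ^ 2 := by ring
      _ ≤ P * (1 + 1 * P) ^ 2 := by gcongr
      _ ≤ R * R ^ 2 := by gcongr <;> linarith
      _ = R ^ 3 := by ring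
  have h5 : t ^ 2 / 2 ≤ t := by nlinarith
  have h6 : |t * ∑ j, l j * (a * l j + b * l j ^ 3)| ≤ t * (n * R ^ 3) := by
    rw [abs_mul, abs_of_pos ht]
    gcongr
  have h7 : |t ^ 2 / 2 * ∑ j, (a * l j + b * l j ^ 3) ^ 2| ≤ t * (n * R ^ 3) := by
    rw [abs_mul, abs_of_nonneg (by positivity)]
    gcongr
  unfold cubicLogJacobian
  refine (abs_sub _ _).trans ?_
  refine (add_le_add (abs_add_le _ _) (abs_add_le _ _)).trans ?_
  linarith

lemma exp_cubicLogJacobian_le {n : ℕ} (β : ℝ) {a b t : ℝ} (ha0 : 0 ≤ a) (ha : a ≤ 1)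
    (hb0 : 0 ≤ b) (hb : b ≤ 1) (ht : 0 < t) (ht1 : t ≤ 1) (l : Fin n → ℝ) :
    exp (cubicLogJacobian β a b t l)
      ≤ (2 + 3 * ∑ j, l j ^ 2) ^ (⌈|β| * n ^ 2⌉₊ + n) := by
  set P := ∑ j, l j ^ 2
  have hP0 : 0 ≤ P := by positivity
  set R := 2 + 3 * P
  have hR0 : 0 < R := by positivity
  have hlogR : 0 ≤ log R := log_nonneg (by linarith)
  have hlog {x : ℝ} (hx0 : 0 ≤ x) (hx : x ≤ 1 + 3 * P) : log (1 + t * x) ≤ log R := by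
    apply log_le_log (by positivity)
    nlinarith
  have h1 : β * ∑ p ∈ ltPairs n, log (1 + t * cubicSlope a b (l p.1) (l p.2))
      ≤ ⌈|β| * n ^ 2⌉₊ * log R := by
    have h0 : 0 ≤ ∑ p ∈ ltPairs n, log (1 + t * cubicSlope a b (l p.1) (l p.2)) :=
      Finset.sum_nonneg fun p _ =>
        (log_one_add_mul_mem ht.le (cubicSlope_nonneg ha0 hb0 (l p.1) (l p.2))).1
    calc _ ≤ |β| * ∑ p ∈ ltPairs n, log (1 + t * cubicSlope a b (l p.1) (l p.2)) := by
          gcongr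
          exact le_abs_self β
      _ ≤ |β| * ((ltPairs n).card • log R) := by
          gcongr
          exact Finset.sum_le_card_nsmul _ _ _ fun p _ =>
            hlog (cubicSlope_nonneg ha0 hb0 _ _) (cubicSlope_le ha hb0 hb l p.1 p.2)
      _ ≤ |β| * (n ^ 2 * log R) := by
          rw [nsmul_eq_mul]
          gcongr
          exact card_ltPairs_le n
      _ = (|β| * n ^ 2) * log R := by ring
      _ ≤ _ := by
          gcongr
          exact Nat.le_ceil _
  have h2 : ∑ j, log (1 + t * (a + 3 * b * l j ^ 2)) ≤ n * log R := by
    have h := Finset.sum_le_card_nsmul Finset.univ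
      (fun j => log (1 + t * (a + 3 * b * l j ^ 2))) (log R) fun j _ =>
        hlog (by positivity) (by nlinarith [sq_le_sum_sq l j, sq_nonneg (l j)])
    simpa using h
  have h3 : 0 ≤ ∑ j, l j * (a * l j + b * l j ^ 3) := Finset.sum_nonneg fun j _ => by
    rw [show l j * (a * l j + b * l j ^ 3) = a * l j ^ 2 + b * (l j ^ 2) ^ 2 by ring]
    positivity
  have h4 : 0 ≤ ∑ j, (a * l j + b * l j ^ 3) ^ 2 := by positivity
  have h5 : cubicLogJacobian β a b t l ≤ (⌈|β| * n ^ 2⌉₊ + n : ℕ) * log R := by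
    unfold cubicLogJacobian
    push_cast
    have h6 : 0 ≤ t * ∑ j, l j * (a * l j + b * l j ^ 3) := by positivity
    have h7 : 0 ≤ t ^ 2 / 2 * ∑ j, (a * l j + b * l j ^ 3) ^ 2 := by positivity
    linarith
  refine (exp_le_exp.2 h5).trans_eq ?_
  rw [exp_nat_mul, exp_log hR0]

lemma gbe_cubic_identity {n : ℕ} (hn : n ≠ 0) {β : ℝ} (hβ : -2 / n < β) {a b : ℝ}
    (ha0 : 0 ≤ a) (ha : a ≤ 1) (hb0 : 0 ≤ b) (hb : b ≤ 1) :
    ∫ l : Fin n → ℝ, gbeWeight β l * (β * ∑ p ∈ ltPairs n, cubicSlope a b (l p.1) (l p.2)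
      + ∑ j, (a + 3 * b * l j ^ 2) - ∑ j, l j * (a * l j + b * l j ^ 3)) = 0 := by
  refine integral_gbeWeight_mul_deriv_eq_zero hn hβ (h := cubicLogJacobian β a b)
    (fun t => ?_) (fun l => by simp [cubicLogJacobian]) (fun l => ?_) (|β| * n ^ 2 + 3 * n) 3
    (⌈|β| * n ^ 2⌉₊ + n)
    (fun t l ht ht1 => abs_cubicLogJacobian_le β ha0 ha hb0 hb ht ht1 l)
    (fun t l ht ht1 => exp_cubicLogJacobian_le β ha0 ha hb0 hb ht ht1 l)
    fun t ht => gbe_cubic_invariance β ha0 hb0 ht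
  · unfold cubicLogJacobian cubicSlope
    fun_prop
  · have h1 := (HasDerivAt.fun_sum (u := ltPairs n) fun p _ =>
      hasDerivAt_log_one_add_mul (cubicSlope a b (l p.1) (l p.2))).const_mul β
    have h2 := HasDerivAt.fun_sum (u := Finset.univ) fun j _ =>
      hasDerivAt_log_one_add_mul (a + 3 * b * l j ^ 2)
    have h3 := (hasDerivAt_id (0 : ℝ)).mul_const (∑ j, l j * (a * l j + b * l j ^ 3))
    have h4 := (((hasDerivAt_id (0 : ℝ)).pow 2).div_const 2).mul_const
      (∑ j, (a * l j + b * l j ^ 3) ^ 2)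
    exact ((h1.add h2).sub (h3.add h4)).congr_deriv (by simp)

lemma integral_gbeWeight_pos {n : ℕ} (hn : n ≠ 0) {β : ℝ} (hβ : -2 / n < β) :
    0 < ∫ l : Fin n → ℝ, gbeWeight β l := by
  have hw : Integrable fun l : Fin n → ℝ => gbeWeight β l := by
    simpa using integrable_gbeWeight_mul_pow hn hβ 0
  rw [integral_pos_iff_support_of_nonneg (gbeWeight_nonneg β) hw]
  let U : Set (Fin n → ℝ) := {l | ∏ p ∈ ltPairs n, (l p.2 - l p.1) ≠ 0}
  have hU : IsOpen U := isOpen_ne_fun (by fun_prop) continuous_const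
  refine (hU.measure_pos volume ⟨fun i => (i : ℝ), ?_⟩).trans_le (measure_mono fun l hl => ?_)
  · refine Finset.prod_ne_zero_iff.2 fun p hp => sub_ne_zero.2 ?_
    have : p.1 < p.2 := by simpa using hp
    simpa using Fin.val_ne_of_ne this.ne'
  · have : 0 < |∏ p ∈ ltPairs n, (l p.2 - l p.1)| := abs_pos.2 hl
    have : 0 < gbeWeight β l := by
      unfold gbeWeight
      positivity
    exact this.ne'

lemma integral_gbeWeight_mul_p4 {n : ℕ} (hn : n ≠ 0) {β : ℝ} (hβ : -2 / n < β) :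
    ∫ l : Fin n → ℝ, gbeWeight β l * ∑ j, l j ^ 4
      = (2 * (β / 2) ^ 2 * n ^ 3 + 5 * (β / 2) * (1 - β / 2) * n ^ 2
        + (β / 2 + 3 * (1 - β / 2) ^ 2) * n) * ∫ l : Fin n → ℝ, gbeWeight β l := by
  have hP0 (l : Fin n → ℝ) : 0 ≤ ∑ j, l j ^ 2 := by positivity
  have hw : Integrable fun l : Fin n → ℝ => gbeWeight β l := by
    simpa using integrable_gbeWeight_mul_pow hn hβ 0
  have hw1 : Integrable fun l : Fin n → ℝ => gbeWeight β l * (∑ j, l j) ^ 2 := by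
    refine integrable_gbeWeight_mul hn hβ (by fun_prop) n 1 fun l => ?_
    rw [abs_of_nonneg (sq_nonneg _), pow_one]
    refine (sq_sum_le_card_mul l).trans ?_
    gcongr
    linarith [hP0 l]
  have hw2 : Integrable fun l : Fin n → ℝ => gbeWeight β l * ∑ j, l j ^ 2 := by
    refine integrable_gbeWeight_mul hn hβ (by fun_prop) 1 1 fun l => ?_
    rw [abs_of_nonneg (hP0 l)]
    linarith [hP0 l]
  have hw4 : Integrable fun l : Fin n → ℝ => gbeWeight β l * ∑ j, l j ^ 4 := by
    refine integrable_gbeWeight_mul hn hβ (by fun_prop) n 2 fun l => ?_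
    rw [abs_of_nonneg (by positivity)]
    have h := Finset.sum_le_card_nsmul Finset.univ (fun j => l j ^ 4)
      ((2 + 3 * ∑ j, l j ^ 2) ^ 2) fun j _ => ?_
    · simpa using h
    · have := sq_le_sum_sq l j
      calc l j ^ 4 = (l j ^ 2) ^ 2 := by ring
        _ ≤ _ := by
          gcongr
          linarith [hP0 l]
  have e1 := gbe_p1_sq hn hβ
  have e2 := gbe_cubic_identity hn hβ zero_le_one le_rfl le_rfl zero_le_one
  have e4 := gbe_cubic_identity hn hβ le_rfl zero_le_one zero_le_one le_rfl
  have s1 : ∫ l : Fin n → ℝ, gbeWeight β l * (n - (∑ j, l j) ^ 2)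
      = n * (∫ l : Fin n → ℝ, gbeWeight β l)
        - ∫ l : Fin n → ℝ, gbeWeight β l * (∑ j, l j) ^ 2 := by
    rw [← integral_const_mul, ← integral_sub (hw.const_mul _) hw1]
    congr with l
    ring
  have s2 : ∫ l : Fin n → ℝ, gbeWeight β l * (β * ∑ p ∈ ltPairs n, cubicSlope 1 0 (l p.1) (l p.2)
      + ∑ j, (1 + 3 * 0 * l j ^ 2) - ∑ j, l j * (1 * l j + 0 * l j ^ 3))
      = (β / 2 * (n ^ 2 - n) + n) * (∫ l : Fin n → ℝ, gbeWeight β l)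
        - ∫ l : Fin n → ℝ, gbeWeight β l * ∑ j, l j ^ 2 := by
    rw [← integral_const_mul, ← integral_sub (hw.const_mul _) hw2]
    congr with l
    have h := two_mul_sum_cubicSlope 1 0 l
    have h' : ∑ j, l j * (1 * l j + 0 * l j ^ 3) = ∑ j, l j ^ 2 :=
      Finset.sum_congr rfl fun j _ => by ring
    rw [h']
    simp only [mul_zero, zero_mul, add_zero, Finset.sum_const, Finset.card_univ, Fintype.card_fin,
      nsmul_eq_mul]
    linear_combination (gbeWeight β l * β / 2) * h
  have s4 : ∫ l : Fin n → ℝ, gbeWeight β l * (β * ∑ p ∈ ltPairs n, cubicSlope 0 1 (l p.1) (l p.2)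
      + ∑ j, (0 + 3 * 1 * l j ^ 2) - ∑ j, l j * (0 * l j + 1 * l j ^ 3))
      = (β / 2 * (2 * n - 3) + 3) * (∫ l : Fin n → ℝ, gbeWeight β l * ∑ j, l j ^ 2)
        + β / 2 * (∫ l : Fin n → ℝ, gbeWeight β l * (∑ j, l j) ^ 2)
        - ∫ l : Fin n → ℝ, gbeWeight β l * ∑ j, l j ^ 4 := by
    rw [← integral_const_mul, ← integral_const_mul,
      ← integral_add (hw2.const_mul _) (hw1.const_mul _),
      ← integral_sub ((hw2.const_mul _).fun_add (hw1.const_mul _)) hw4]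
    congr with l
    have h := two_mul_sum_cubicSlope 0 1 l
    have h' : ∑ j, l j * (0 * l j + 1 * l j ^ 3) = ∑ j, l j ^ 4 :=
      Finset.sum_congr rfl fun j _ => by ring
    have h'' : ∑ j, (0 + 3 * 1 * l j ^ 2) = 3 * ∑ j, l j ^ 2 := by
      rw [Finset.mul_sum]
      exact Finset.sum_congr rfl fun j _ => by ring
    rw [h', h'']
    linear_combination (gbeWeight β l * β / 2) * h
  rw [s1] at e1
  rw [s2] at e2
  rw [s4] at e4
  linear_combination -(β / 2 * (2 * n - 3) + 3) * e2 - β / 2 * e1 - e4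

/-- `⟨p₄(λ)⟩_{β,n} = 2(β/2)²n³ + 5(β/2)(1-β/2)n² + ((β/2)+3(1-β/2)²)n`. -/
theorem gbe_p4_mean (n : ℕ) (hn : 2 ≤ n) (β : ℝ) (hβ : -2 / n < β)
    (Z : ℝ) (μ : Measure (Fin n → ℝ))
    (hZ : Z = ∫ l : Fin n → ℝ,
      |∏ p ∈ Finset.univ.filter (fun p : Fin n × Fin n => p.1 < p.2), (l p.2 - l p.1)| ^ β
        * Real.exp (-(∑ j, l j ^ 2) / 2))
    (hμ : μ = (volume : Measure (Fin n → ℝ)).withDensity fun l =>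
      ENNReal.ofReal (Z⁻¹ *
        (|∏ p ∈ Finset.univ.filter (fun p : Fin n × Fin n => p.1 < p.2), (l p.2 - l p.1)| ^ β
          * Real.exp (-(∑ j, l j ^ 2) / 2)))) :
    (∫ l, (∑ j, l j ^ 4) ∂μ) = 2 * (β / 2) ^ 2 * n ^ 3 + 5 * (β / 2) * (1 - β / 2) * n ^ 2 + (β / 2 + 3 * (1 - β / 2) ^ 2) * n := by
  have hn0 : n ≠ 0 := by omega
  have hμ' : μ = (volume : Measure (Fin n → ℝ)).withDensity fun l =>
      ENNReal.ofReal (Z⁻¹ * gbeWeight β l) := hμ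
  have hZ' : Z = ∫ l : Fin n → ℝ, gbeWeight β l := hZ
  have hpos : 0 < Z := hZ' ▸ integral_gbeWeight_pos hn0 hβ
  have hmeas := measurable_gbeWeight (n := n) β
  rw [hμ', integral_withDensity_eq_integral_toReal_smul (by fun_prop)
    (.of_forall fun _ => ENNReal.ofReal_lt_top)]
  have h (l : Fin n → ℝ) : (ENNReal.ofReal (Z⁻¹ * gbeWeight β l)).toReal • ∑ j, l j ^ 4
      = Z⁻¹ * (gbeWeight β l * ∑ j, l j ^ 4) := by
    rw [ENNReal.toReal_ofReal (mul_nonneg (by positivity) (gbeWeight_nonneg β l)), smul_eq_mul,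
      mul_assoc]
  simp only [h]
  rw [integral_const_mul, integral_gbeWeight_mul_p4 hn0 hβ, ← hZ']
  field_simp
end

section
/- Let n = 2, β ≥ 0, and on a finite connected electrical network G with killing measure K, let φ be a scalar GFF with covariance G_{G,K} and L an independent (β+1)/2-permanental field with kernel G_{G,K}. Define λ₁(x) = φ(x)/√2 + √(L(x)) and λ₂(x) = φ(x)/√2 - √(L(x)). Then for every vertex x, the pair (λ₁(x),λ₂(x))/√(G_{G,K}(x,x)) is distributed, up to ordering, as the Gaussian beta ensemble with n = 2, i.e., with density proportional to |λ₁ - λ₂|^β exp(-(λ₁²+λ₂²)/2). -/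
open MeasureTheory ProbabilityTheory Real

/-- The integral over the line of an even function is twice its integral over `(0, ∞)`. -/
lemma lintegral_eq_two_mul_setLIntegral_Ioi_of_even {h : ℝ → ENNReal} (heven : ∀ d, h (-d) = h d) :
    ∫⁻ d, h d = 2 * ∫⁻ d in Set.Ioi 0, h d := by
  have hneg : ∫⁻ d in Set.Iio 0, h d = ∫⁻ d in Set.Ioi 0, h d := by
    have := (Measure.measurePreserving_neg (volume : Measure ℝ)).setLIntegral_comp_preimage_emb
      (MeasurableEquiv.neg ℝ).measurableEmbedding h (Set.Iio 0)
    simpa [heven] using this.symm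
  rw [← lintegral_add_compl h (measurableSet_Iio (a := (0 : ℝ))), Set.compl_Iio, hneg,
    setLIntegral_congr Ioi_ae_eq_Ici.symm, two_mul]

/-- The substitution `y = d ^ 2 / 2` on `(0, ∞)`. -/
lemma setLIntegral_Ioi_eq_setLIntegral_Ioi_comp_sq_div_two (h : ℝ → ENNReal) :
    ∫⁻ y in Set.Ioi 0, h y = ∫⁻ d in Set.Ioi 0, ENNReal.ofReal d * h (d ^ 2 / 2) := by
  have himage : (fun d : ℝ => d ^ 2 / 2) '' Set.Ioi 0 = Set.Ioi 0 := by
    ext y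
    simp only [Set.mem_image, Set.mem_Ioi]
    constructor
    · rintro ⟨d, hd, rfl⟩
      positivity
    · intro hy
      refine ⟨√(2 * y), by positivity, ?_⟩
      rw [Real.sq_sqrt (by positivity)]
      ring
  have hderiv : ∀ d ∈ Set.Ioi (0 : ℝ),
      HasDerivWithinAt (fun d : ℝ => d ^ 2 / 2) d (Set.Ioi 0) d := by
    intro d _
    exact (((hasDerivAt_pow 2 d).div_const 2).congr_deriv (by simp)).hasDerivWithinAt
  have hinj : Set.InjOn (fun d : ℝ => d ^ 2 / 2) (Set.Ioi 0) := by
    intro a ha b hb hab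
    simp only [Set.mem_Ioi] at ha hb hab
    nlinarith
  have := lintegral_image_eq_lintegral_abs_deriv_mul measurableSet_Ioi hderiv hinj h
  rw [himage] at this
  rw [this]
  refine setLIntegral_congr_fun measurableSet_Ioi fun d hd => ?_
  simp only [abs_of_pos (Set.mem_Ioi.mp hd)]

lemma measurable_gammaPDF (a r : ℝ) : Measurable (gammaPDF a r) :=
  (measurable_gammaPDFReal a r).ennreal_ofReal

lemma lintegral_gammaMeasure (a r : ℝ) {g : ℝ → ENNReal} (hg : Measurable g) :
    ∫⁻ y, g y ∂gammaMeasure a r = ∫⁻ y in Set.Ioi 0, gammaPDF a r y * g y := by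
  rw [gammaMeasure, lintegral_withDensity_eq_lintegral_mul _ (measurable_gammaPDF a r) hg,
    ← lintegral_add_compl _ (measurableSet_Iio (a := (0 : ℝ))), Set.compl_Iio,
    setLIntegral_congr Ioi_ae_eq_Ici.symm]
  rw [setLIntegral_congr_fun (g := fun _ => 0) measurableSet_Iio
    fun y hy => by simp [gammaPDF_of_neg (Set.mem_Iio.mp hy)]]
  simp

/-- For `y = d ^ 2 / 2`, the weight `|√2 d| ^ β * exp (-d ^ 2 / 2)` is, up to a constant, the
gamma density of shape `(β + 1) / 2` at `y` times the Jacobian `d`. -/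
lemma rpow_mul_exp_eq_mul_gammaPDFReal {β d : ℝ} (hβ : 0 ≤ β) (hd : 0 < d) :
    |√2 * d| ^ β * exp (-d ^ 2 / 2)
      = 2 ^ β / √2 * Gamma ((β + 1) / 2) * (d * gammaPDFReal ((β + 1) / 2) 1 (d ^ 2 / 2)) := by
  have hΓ : Gamma ((β + 1) / 2) ≠ 0 := (Gamma_pos_of_pos (by positivity)).ne'
  have hroot : √2 * d = 2 * (d ^ 2 / 2) ^ (1 / 2 : ℝ) := by
    rw [← Real.sqrt_eq_rpow, Real.sqrt_div (sq_nonneg d), Real.sqrt_sq hd.le]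
    field_simp
    norm_num
  have hd' : d = √2 * (d ^ 2 / 2) ^ (1 / 2 : ℝ) := by
    have h2 : √2 * √2 = 2 := Real.mul_self_sqrt (by norm_num)
    have : √2 * (√2 * d) = √2 * (2 * (d ^ 2 / 2) ^ (1 / 2 : ℝ)) := by rw [hroot]
    linear_combination this / 2 - h2 * d / 2
  have hy : 0 < d ^ 2 / 2 := by positivity
  have hpow : d * (d ^ 2 / 2) ^ ((β + 1) / 2 - 1) = √2 * (d ^ 2 / 2) ^ (β / 2) := by
    calc d * (d ^ 2 / 2) ^ ((β + 1) / 2 - 1)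
        = √2 * (d ^ 2 / 2) ^ (1 / 2 : ℝ) * (d ^ 2 / 2) ^ ((β + 1) / 2 - 1) := by rw [← hd']
      _ = √2 * (d ^ 2 / 2) ^ (β / 2) := by
        rw [mul_assoc, ← Real.rpow_add hy]
        congr 2
        ring
  rw [abs_of_pos (by positivity), hroot, Real.mul_rpow (by norm_num) (by positivity),
    ← Real.rpow_mul hy.le, gammaPDFReal, if_pos hy.le, Real.one_rpow]
  have : 2 ^ β / √2 * Gamma ((β + 1) / 2) * (d * (1 / Gamma ((β + 1) / 2) *
      (d ^ 2 / 2) ^ ((β + 1) / 2 - 1) * exp (-(1 * (d ^ 2 / 2)))))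
      = 2 ^ β / √2 * (d * (d ^ 2 / 2) ^ ((β + 1) / 2 - 1)) * exp (-(1 * (d ^ 2 / 2))) := by
    field_simp
  rw [this, hpow]
  have hs : √2 ≠ 0 := by positivity
  field_simp

/-- The image of the weight `|√2 d| ^ β * exp (-d ^ 2 / 2)` under `d ↦ d ^ 2 / 2` is proportional
to a gamma law. -/
lemma map_sq_div_two_withDensity_eq_smul_gammaMeasure {β : ℝ} (hβ : 0 ≤ β) :
    Measure.map (fun d : ℝ => d ^ 2 / 2)
        (volume.withDensity fun d => ENNReal.ofReal (|√2 * d| ^ β * exp (-d ^ 2 / 2)))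
      = ENNReal.ofReal (2 * (2 ^ β / √2 * Gamma ((β + 1) / 2))) •
        gammaMeasure ((β + 1) / 2) 1 := by
  have hΓ : 0 < Gamma ((β + 1) / 2) := Gamma_pos_of_pos (by positivity)
  refine Measure.ext_of_lintegral _ fun g hg => ?_
  rw [lintegral_map hg (by fun_prop),
    lintegral_withDensity_eq_lintegral_mul _ (by fun_prop) (by fun_prop),
    lintegral_smul_measure, lintegral_gammaMeasure _ _ hg,
    lintegral_eq_two_mul_setLIntegral_Ioi_of_even (by simp),
    setLIntegral_Ioi_eq_setLIntegral_Ioi_comp_sq_div_two (fun y => _ * g y),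
    ENNReal.ofReal_mul zero_le_two,
    smul_eq_mul, mul_assoc, ENNReal.ofReal_ofNat]
  congr 1
  rw [← lintegral_const_mul' _ _ ENNReal.ofReal_ne_top]
  refine setLIntegral_congr_fun measurableSet_Ioi fun d hd => ?_
  simp only [Pi.mul_apply]
  rw [rpow_mul_exp_eq_mul_gammaPDFReal hβ hd, ENNReal.ofReal_mul (by positivity),
    ENNReal.ofReal_mul (le_of_lt hd), gammaPDF]
  ring

/-- The map `(a, b) ↦ ((a + b) / √2, (a - b) / √2)` preserves Lebesgue measure. -/
lemma map_add_sub_div_sqrt_two_volume :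
    Measure.map (fun p : ℝ × ℝ => ((p.1 + p.2) / √2, (p.1 - p.2) / √2)) volume = volume := by
  let A : Matrix (Fin 2) (Fin 2) ℝ := !![1 / √2, 1 / √2; 1 / √2, -(1 / √2)]
  let R := Matrix.toLin (Module.Basis.finTwoProd ℝ) (Module.Basis.finTwoProd ℝ) A
  have h2 : √2 * √2 = 2 := Real.mul_self_sqrt (by norm_num)
  have hdet : LinearMap.det R = -1 := by
    rw [LinearMap.det_toLin, Matrix.det_fin_two_of]
    have : √2 ≠ 0 := by positivity
    field_simp
    norm_num
  have hR : (fun p : ℝ × ℝ => ((p.1 + p.2) / √2, (p.1 - p.2) / √2)) = R := by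
    ext p <;> simp only [R, A, Matrix.toLin_finTwoProd_apply] <;> ring
  rw [hR, Measure.map_linearMap_addHaar_eq_smul_addHaar _ (by rw [hdet]; norm_num), hdet]
  simp

/-- Under the unnormalized two-point Gaussian beta weight, `(a + b) / √2` and `(a - b) ^ 2 / 4` are
independent, up to a constant standard Gaussian and gamma distributed. -/
lemma map_withDensity_gbe_two_eq_smul_prod {β : ℝ} (hβ : 0 ≤ β) :
    Measure.map (fun p : ℝ × ℝ => ((p.1 + p.2) / √2, ((p.1 - p.2) / √2) ^ 2 / 2))
        ((volume : Measure (ℝ × ℝ)).withDensity fun p =>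
          ENNReal.ofReal (|p.1 - p.2| ^ β * exp (-(p.1 ^ 2 + p.2 ^ 2) / 2)))
      = ENNReal.ofReal (√(2 * π) * (2 * (2 ^ β / √2 * Gamma ((β + 1) / 2)))) •
        (gaussianReal 0 1).prod (gammaMeasure ((β + 1) / 2) 1) := by
  have := isProbabilityMeasure_gammaMeasure (a := (β + 1) / 2) (r := 1) (by positivity) one_pos
  set v : ℝ → ENNReal := fun d => ENNReal.ofReal (|√2 * d| ^ β * exp (-d ^ 2 / 2)) with hv
  set R : ℝ × ℝ → ℝ × ℝ := fun p => ((p.1 + p.2) / √2, (p.1 - p.2) / √2) with hR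
  have hRmeas : Measurable R := by fun_prop
  have hvmeas : Measurable v := by fun_prop
  have hW : Measurable fun q : ℝ × ℝ => gaussianPDF 0 1 q.1 * v q.2 := by fun_prop
  have hWR : Measurable fun p : ℝ × ℝ => gaussianPDF 0 1 (R p).1 * v (R p).2 := hW.comp hRmeas
  have hdensity : (fun p : ℝ × ℝ =>
      ENNReal.ofReal (|p.1 - p.2| ^ β * exp (-(p.1 ^ 2 + p.2 ^ 2) / 2)))
      = ENNReal.ofReal √(2 * π) • fun p => gaussianPDF 0 1 (R p).1 * v (R p).2 := by
    funext p
    have hs : √2 ≠ 0 := by positivity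
    have hπ : √(2 * π) ≠ 0 := by positivity
    simp only [Pi.smul_apply, smul_eq_mul, hv, hR, gaussianPDF, gaussianPDFReal]
    rw [← ENNReal.ofReal_mul (by positivity), ← ENNReal.ofReal_mul (by positivity)]
    congr 1
    have hexp : exp (-(p.1 ^ 2 + p.2 ^ 2) / 2)
        = exp (-((p.1 + p.2) / √2) ^ 2 / 2) * exp (-((p.1 - p.2) / √2) ^ 2 / 2) := by
      rw [← exp_add, div_pow, div_pow, Real.sq_sqrt zero_le_two]
      congr 1
      ring
    rw [mul_div_cancel₀ _ hs, hexp]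
    simp only [NNReal.coe_one, mul_one, sub_zero]
    field_simp
  have hrot : Measure.map R (volume.withDensity fun p => gaussianPDF 0 1 (R p).1 * v (R p).2)
      = (gaussianReal 0 1).prod (volume.withDensity v) := by
    rw [gaussianReal_of_var_ne_zero _ one_ne_zero,
      prod_withDensity (measurable_gaussianPDF 0 1) hvmeas, ← Measure.volume_eq_prod]
    refine Measure.ext_of_lintegral _ fun g hg => ?_
    rw [lintegral_map hg hRmeas, lintegral_withDensity_eq_lintegral_mul _ hWR
      (by fun_prop), lintegral_withDensity_eq_lintegral_mul _ hW hg]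
    conv_rhs => rw [← map_add_sub_div_sqrt_two_volume]
    rw [lintegral_map (hW.mul hg) hRmeas]
    rfl
  have hcomp : (fun p : ℝ × ℝ => ((p.1 + p.2) / √2, ((p.1 - p.2) / √2) ^ 2 / 2))
      = Prod.map id (fun d : ℝ => d ^ 2 / 2) ∘ R := rfl
  have hsq : Measurable fun d : ℝ => d ^ 2 / 2 := by fun_prop
  rw [hdensity, withDensity_smul _ hWR, Measure.map_smul, hcomp,
    ← Measure.map_map (measurable_id.prodMap hsq) hRmeas, hrot,
    ← Measure.map_prod_map _ _ measurable_id hsq, Measure.map_id,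
    map_sq_div_two_withDensity_eq_smul_gammaMeasure hβ, Measure.prod_smul_right, smul_smul,
    ENNReal.ofReal_mul (Real.sqrt_nonneg (2 * π))]

/-- For the two-point Gaussian beta ensemble, `(a + b) / √2` and `(a - b) ^ 2 / 4` are independent,
with standard Gaussian and gamma laws respectively. -/
lemma map_gbe_two_eq_prod {β : ℝ} (hβ : 0 ≤ β) :
    Measure.map (fun p : ℝ × ℝ => ((p.1 + p.2) / √2, ((p.1 - p.2) / √2) ^ 2 / 2))
        ((volume : Measure (ℝ × ℝ)).withDensity fun p => ENNReal.ofReal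
          ((∫ q : ℝ × ℝ, |q.1 - q.2| ^ β * exp (-(q.1 ^ 2 + q.2 ^ 2) / 2))⁻¹ *
            (|p.1 - p.2| ^ β * exp (-(p.1 ^ 2 + p.2 ^ 2) / 2))))
      = (gaussianReal 0 1).prod (gammaMeasure ((β + 1) / 2) 1) := by
  have := isProbabilityMeasure_gammaMeasure (a := (β + 1) / 2) (r := 1) (by positivity) one_pos
  have hΓ : 0 < Gamma ((β + 1) / 2) := Gamma_pos_of_pos (by positivity)
  have hmap := map_withDensity_gbe_two_eq_smul_prod hβ
  set c : ℝ := √(2 * π) * (2 * (2 ^ β / √2 * Gamma ((β + 1) / 2)))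
  have hcpos : 0 < c := by positivity
  have hZ : ∫ q : ℝ × ℝ, |q.1 - q.2| ^ β * exp (-(q.1 ^ 2 + q.2 ^ 2) / 2) = c := by
    have hmass := congrArg (fun m => m Set.univ) hmap
    simp only [Measure.smul_apply, measure_univ, smul_eq_mul, mul_one] at hmass
    rw [Measure.map_apply (by fun_prop) MeasurableSet.univ, Set.preimage_univ,
      withDensity_apply _ MeasurableSet.univ, Measure.restrict_univ] at hmass
    rw [integral_eq_lintegral_of_nonneg_ae (ae_of_all _ fun q => by positivity)
      (by fun_prop), hmass, ENNReal.toReal_ofReal hcpos.le]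
  have hdensity : (fun p : ℝ × ℝ =>
      ENNReal.ofReal (c⁻¹ * (|p.1 - p.2| ^ β * exp (-(p.1 ^ 2 + p.2 ^ 2) / 2))))
      = ENNReal.ofReal c⁻¹ • fun p : ℝ × ℝ =>
        ENNReal.ofReal (|p.1 - p.2| ^ β * exp (-(p.1 ^ 2 + p.2 ^ 2) / 2)) := by
    funext p
    simp only [Pi.smul_apply, smul_eq_mul]
    rw [ENNReal.ofReal_mul (by positivity)]
  rw [hZ, hdensity, withDensity_smul _ (by fun_prop), Measure.map_smul, hmap, smul_smul,
    ← ENNReal.ofReal_mul (by positivity), inv_mul_cancel₀ hcpos.ne', ENNReal.ofReal_one, one_smul]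

/-- The ordered pair is recovered from the sum and the squared difference. -/
lemma max_min_eq_add_sub_sqrt (a b : ℝ) :
    (max a b, min a b) = ((a + b) / √2 / √2 + √(((a - b) / √2) ^ 2 / 2),
      (a + b) / √2 / √2 - √(((a - b) / √2) ^ 2 / 2)) := by
  have h2 : √2 * √2 = 2 := Real.mul_self_sqrt zero_le_two
  have hroot : √(((a - b) / √2) ^ 2 / 2) = |a - b| / 2 := by
    rw [Real.sqrt_div (sq_nonneg _), Real.sqrt_sq_eq_abs, abs_div,
      abs_of_nonneg (Real.sqrt_nonneg 2), div_div, h2]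
  rw [div_div, h2, hroot, sup_eq_half_smul_add_add_abs_sub' ℝ, inf_eq_half_smul_add_sub_abs_sub' ℝ,
    abs_sub_comm b a]
  simp only [Prod.mk.injEq, smul_eq_mul]
  constructor <;> ring

/-- On a finite electrical network, let `φ` be a scalar GFF with covariance `G_{G,K}` and
`L` an independent `(β+1)/2`-permanental field with kernel `G_{G,K}`, and set
`λ₁ = φ/√2 + √L`, `λ₂ = φ/√2 - √L`. Then at each vertex `x`, the pair
`(λ₁(x), λ₂(x))/√(G(x,x))` is distributed, up to ordering, as the Gaussian beta ensemble
with `n = 2`, of density proportional to `|a-b|^β exp(-(a²+b²)/2)`. -/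
theorem n_two_construction_gbe_marginal
    {V : Type*} [Fintype V] {Ω : Type*} [MeasureSpace Ω]
    [IsProbabilityMeasure (ℙ : Measure Ω)]
    (β : ℝ) (hβ : 0 ≤ β)
    (GreenK : V → V → ℝ) (hGpos : ∀ x, 0 < GreenK x x)
    (φ L : Ω → V → ℝ) (hφmeas : Measurable φ) (hLmeas : Measurable L)
    (hLnonneg : ∀ ω x, 0 ≤ L ω x)
    (hφ : ∀ x : V, Measure.map (fun ω => φ ω x) ℙ
      = gaussianReal 0 (Real.toNNReal (GreenK x x)))
    (hL : ∀ x : V, Measure.map (fun ω => L ω x / GreenK x x) ℙ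
      = gammaMeasure ((β + 1) / 2) 1)
    (hindep : IndepFun φ L)
    (lam₁ lam₂ : Ω → V → ℝ)
    (hlam₁ : ∀ ω x, lam₁ ω x = φ ω x / Real.sqrt 2 + Real.sqrt (L ω x))
    (hlam₂ : ∀ ω x, lam₂ ω x = φ ω x / Real.sqrt 2 - Real.sqrt (L ω x))
    (Z : ℝ) (hZ : Z = ∫ p : ℝ × ℝ, |p.1 - p.2| ^ β * Real.exp (-(p.1 ^ 2 + p.2 ^ 2) / 2))
    (μβ : Measure (ℝ × ℝ))
    (hμβ : μβ = (volume : Measure (ℝ × ℝ)).withDensity fun p =>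
      ENNReal.ofReal (Z⁻¹ * (|p.1 - p.2| ^ β * Real.exp (-(p.1 ^ 2 + p.2 ^ 2) / 2)))) :
    ∀ x : V,
      Measure.map (fun ω =>
          (lam₁ ω x / Real.sqrt (GreenK x x), lam₂ ω x / Real.sqrt (GreenK x x))) ℙ
        = Measure.map (fun p : ℝ × ℝ => (max p.1 p.2, min p.1 p.2)) μβ := by
  intro x
  have hG := hGpos x
  have hφx : Measurable fun ω => φ ω x := (measurable_pi_apply x).comp hφmeas
  have hLx : Measurable fun ω => L ω x := (measurable_pi_apply x).comp hLmeas
  have hgauss : Measure.map (fun ω => φ ω x / √(GreenK x x)) ℙ = gaussianReal 0 1 := by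
    have h := congrArg (Measure.map (· / √(GreenK x x))) (hφ x)
    rw [Measure.map_map (by fun_prop) hφx, gaussianReal_map_div_const] at h
    have hvar : (GreenK x x).toNNReal / NNReal.mk (√(GreenK x x) ^ 2) (sq_nonneg _) = 1 := by
      apply NNReal.eq
      simp [Real.sq_sqrt hG.le, hG.le, hG.ne']
    rw [hvar, zero_div] at h
    exact h
  have hjoint : Measure.map (fun ω => (φ ω x / √(GreenK x x), L ω x / GreenK x x)) ℙ
      = (gaussianReal 0 1).prod (gammaMeasure ((β + 1) / 2) 1) := by
    have hind : IndepFun (fun ω => φ ω x / √(GreenK x x)) (fun ω => L ω x / GreenK x x) :=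
      hindep.comp (φ := fun f : V → ℝ => f x / √(GreenK x x))
        (ψ := fun f : V → ℝ => f x / GreenK x x)
        (by fun_prop) (by fun_prop)
    rw [(indepFun_iff_map_prod_eq_prod_map_map (by fun_prop) (by fun_prop)).1 hind, hgauss, hL x]
  set F : ℝ × ℝ → ℝ × ℝ := fun q => (q.1 / √2 + √q.2, q.1 / √2 - √q.2) with hF
  have hFmeas : Measurable F := by fun_prop
  have hleft : (fun ω => (lam₁ ω x / √(GreenK x x), lam₂ ω x / √(GreenK x x)))
      = F ∘ fun ω => (φ ω x / √(GreenK x x), L ω x / GreenK x x) := by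
    funext ω
    simp only [hF, Function.comp_apply, hlam₁, hlam₂, Real.sqrt_div (hLnonneg ω x)]
    exact Prod.ext (by ring) (by ring)
  have hright : (fun p : ℝ × ℝ => (max p.1 p.2, min p.1 p.2))
      = F ∘ fun p => ((p.1 + p.2) / √2, ((p.1 - p.2) / √2) ^ 2 / 2) :=
    funext fun p => max_min_eq_add_sub_sqrt p.1 p.2
  rw [hleft, hright, ← Measure.map_map hFmeas (by fun_prop), ← Measure.map_map hFmeas (by fun_prop),
    hjoint, hμβ, hZ, map_gbe_two_eq_prod hβ]
end
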